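/- Let R be an integral domain which is not a field, with quotient field Q. If gldim(R) = pd_R(Q) + 1, then cot.D(R) = pd_R(Q). -/

import Mathlib

open CategoryTheory Opposite

noncomputable section

universe u

variable (R : Type u) [CommRing R]

/-- `ExtVanish R M N n` : the `n`-th Ext group `Ext^n_R(M, N)` vanishes. -/
def ExtVanish (M N : ModuleCat.{u} R) (n : ℕ) : Prop :=
  Subsingleton (((Ext R (ModuleCat.{u} R) n).obj (op M)).obj N)

/-- `TorVanish R M N n` : the `n`-th Tor group `Tor_n^R(M, N)` vanishes. -/
def TorVanish (M N : ModuleCat.{u} R) (n : ℕ) : Prop :=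
  Subsingleton (((Tor (ModuleCat.{u} R) n).obj M).obj N)

/-- `pdLE R M n` : the projective dimension of `M` is at most `n`. -/
def pdLE (M : ModuleCat.{u} R) (n : ℕ) : Prop :=
  ∀ N : ModuleCat.{u} R, ExtVanish R M N (n + 1)

/-- `idLE R M n` : the injective dimension of `M` is at most `n`. -/
def idLE (M : ModuleCat.{u} R) (n : ℕ) : Prop :=
  ∀ N : ModuleCat.{u} R, ExtVanish R N M (n + 1)

/-- `fdLE R M n` : the flat dimension of `M` is at most `n`. -/
def fdLE (M : ModuleCat.{u} R) (n : ℕ) : Prop :=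
  ∀ N : ModuleCat.{u} R, TorVanish R M N (n + 1)

/-- `cdLE R M n` : the cotorsion dimension of `M` is at most `n`, i.e.
`Ext^{n+1}_R(F, M) = 0` for every flat `R`-module `F`. -/
def cdLE (M : ModuleCat.{u} R) (n : ℕ) : Prop :=
  ∀ F : ModuleCat.{u} R, Module.Flat R F → ExtVanish R F M (n + 1)

/-- The projective dimension of a module, as an element of `ℕ∞`. -/
def pd (M : ModuleCat.{u} R) : ℕ∞ := sInf ((↑) '' {n : ℕ | pdLE R M n})

/-- The injective dimension of a module, as an element of `ℕ∞`. -/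
def injd (M : ModuleCat.{u} R) : ℕ∞ := sInf ((↑) '' {n : ℕ | idLE R M n})

/-- The flat dimension of a module, as an element of `ℕ∞`. -/
def fd (M : ModuleCat.{u} R) : ℕ∞ := sInf ((↑) '' {n : ℕ | fdLE R M n})

/-- The cotorsion dimension of a module, as an element of `ℕ∞`. -/
def cd (M : ModuleCat.{u} R) : ℕ∞ := sInf ((↑) '' {n : ℕ | cdLE R M n})

/-- The global dimension of a ring. -/
def gldim : ℕ∞ := ⨆ M : ModuleCat.{u} R, pd R M

/-- The weak global dimension of a ring. -/
def wdim : ℕ∞ := ⨆ M : ModuleCat.{u} R, fd R M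

/-- The global cotorsion dimension of a ring: the supremum of the projective
dimensions of all flat modules. -/
def cotD : ℕ∞ := ⨆ (M : ModuleCat.{u} R) (_ : Module.Flat R M), pd R M

/-- The finitistic projective dimension of a ring. -/
def FPD : ℕ∞ := sSup {d : ℕ∞ | d ≠ ⊤ ∧ ∃ M : ModuleCat.{u} R, pd R M = d}

/-- The finitistic flat dimension of a ring. -/
def FFD : ℕ∞ := sSup {d : ℕ∞ | d ≠ ⊤ ∧ ∃ M : ModuleCat.{u} R, fd R M = d}

/-- The finitistic injective dimension of a ring. -/
def FID : ℕ∞ := sSup {d : ℕ∞ | d ≠ ⊤ ∧ ∃ M : ModuleCat.{u} R, injd R M = d}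

/-- The finitistic cotorsion dimension of a ring. -/
def FCD : ℕ∞ := sSup {d : ℕ∞ | d ≠ ⊤ ∧ ∃ M : ModuleCat.{u} R, cd R M = d}

/-- `R` is `n`-perfect if every flat `R`-module has projective dimension at most `n`. -/
def IsNPerfect (n : ℕ) : Prop :=
  ∀ M : ModuleCat.{u} R, Module.Flat R M → pd R M ≤ n

end

lemma extVanish_succ_iff (R : Type u) [CommRing R] (M N : ModuleCat.{u} R) (n : ℕ) :
    ExtVanish R M N (n + 1) ↔ Subsingleton (Abelian.Ext.{u} M N (n + 1)) := by
  let P := projectiveResolution M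
  have key : Subsingleton (Abelian.Ext.{u} M N (n + 1)) ↔
      ∀ f : P.complex.X (n + 1) ⟶ N, P.complex.d (n + 2) (n + 1) ≫ f = 0 →
        ∃ g : P.complex.X n ⟶ N, P.complex.d (n + 1) n ≫ g = f := by
    constructor
    · intro hs f hf
      exact (P.extMk_eq_zero_iff f (n + 2) rfl hf n rfl).1 (Subsingleton.elim _ _)
    · intro hs
      refine subsingleton_of_forall_eq 0 fun α => ?_
      obtain ⟨f, hf, rfl⟩ := P.extMk_surjective α (n + 2) rfl
      exact (P.extMk_eq_zero_iff f (n + 2) rfl hf n rfl).2 (hs f hf)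
  rw [key]
  unfold ExtVanish
  rw [← ModuleCat.isZero_iff_subsingleton, (P.isoExt (R := R) (n + 1) N).isZero_iff,
    ← HomologicalComplex.exactAt_iff_isZero_homology,
    HomologicalComplex.exactAt_iff' _ n (n + 1) (n + 2) (by simp) (by simp),
    ShortComplex.moduleCat_exact_iff]
  rfl

lemma pdLE_iff (R : Type u) [CommRing R] (M : ModuleCat.{u} R) (n : ℕ) :
    pdLE R M n ↔ HasProjectiveDimensionLE M n := by
  unfold pdLE
  simp only [extVanish_succ_iff]
  exact ⟨fun h => hasProjectiveDimensionLT_of_enoughInjectives M (n + 1) h,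
    fun h N => HasProjectiveDimensionLT.subsingleton M (n + 1) (n + 1) le_rfl N⟩

lemma pd_le_iff (R : Type u) [CommRing R] (M : ModuleCat.{u} R) (n : ℕ) :
    pd R M ≤ n ↔ HasProjectiveDimensionLE M n := by
  rw [← pdLE_iff]
  constructor
  · intro h
    have hlt : pd R M < ((n + 1 : ℕ) : ℕ∞) :=
      lt_of_le_of_lt h (by exact_mod_cast Nat.lt_succ_self n)
    obtain ⟨_, ⟨m, hm, rfl⟩, hmn⟩ := sInf_lt_iff.1 hlt
    have hmn' : m < n + 1 := by exact_mod_cast hmn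
    have hm' : HasProjectiveDimensionLT M (m + 1) := (pdLE_iff R M m).1 hm
    exact (pdLE_iff R M n).2 (hasProjectiveDimensionLT_of_ge M (m + 1) (n + 1) (by omega))
  · intro h
    exact sInf_le ⟨n, h, rfl⟩

lemma finsupp_pd_step (R : Type u) [CommRing R] (ι : Type u) (n : ℕ)
    (A B C : Type u) [AddCommGroup A] [Module R A] [AddCommGroup B] [Module R B]
    [AddCommGroup C] [Module R C] (f : A →ₗ[R] B) (p : B →ₗ[R] C)
    (hf : Function.Injective f) (hp : Function.Surjective p) (hfp : Function.Exact f p)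
    (hB : Module.Projective R B) (hB' : Module.Projective R (ι →₀ B))
    (ih : HasProjectiveDimensionLE (ModuleCat.of R A) n →
      HasProjectiveDimensionLE (ModuleCat.of R (ι →₀ A)) n)
    (h : HasProjectiveDimensionLE (ModuleCat.of R C) (n + 1)) :
    HasProjectiveDimensionLE (ModuleCat.of R (ι →₀ C)) (n + 1) := by
  let S : ShortComplex (ModuleCat.{u} R) :=
    ShortComplex.mk (ModuleCat.ofHom f) (ModuleCat.ofHom p)
      (by
        apply ModuleCat.hom_ext
        refine LinearMap.ext fun x => ?_
        exact hfp.apply_apply_eq_zero x)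
  have hS : S.ShortExact :=
    { exact := (ShortComplex.moduleCat_exact_iff _).2 fun x hx => (hfp x).1 hx
      mono_f := (ModuleCat.mono_iff_injective _).2 hf
      epi_g := (ModuleCat.epi_iff_surjective _).2 hp }
  let T : ShortComplex (ModuleCat.{u} R) :=
    ShortComplex.mk (ModuleCat.ofHom (Finsupp.mapRange.linearMap (α := ι) f))
      (ModuleCat.ofHom (Finsupp.mapRange.linearMap (α := ι) p))
      (by
        apply ModuleCat.hom_ext
        refine LinearMap.ext fun x => Finsupp.ext (M := C) fun i => ?_
        exact hfp.apply_apply_eq_zero ((show ι →₀ A from x) i))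
  have hT : T.ShortExact :=
    { exact := (ShortComplex.moduleCat_exact_iff _).2 fun (x : ι →₀ B) hx => by
        have hx' : ∀ i, ∃ a, f a = x i := fun i =>
          (hfp (x i)).1 (congrArg (fun y : ι →₀ C => y i) hx)
        choose g hg using hx'
        refine ⟨(Finsupp.onFinset x.support g (fun i hi => ?_) : ι →₀ A), ?_⟩
        · rw [Finsupp.mem_support_iff]
          intro h0
          exact hi (hf (by rw [hg, h0, map_zero]))
        · exact Finsupp.ext (M := B) fun i => hg i
      mono_f := (ModuleCat.mono_iff_injective _).2
        (Finsupp.mapRange_injective _ (map_zero _) hf)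
      epi_g := (ModuleCat.epi_iff_surjective _).2
        (Finsupp.mapRange_surjective _ (map_zero _) hp) }
  have hS2 : Projective S.X₂ := (IsProjective.iff_projective (R := R) B).1 hB
  have hT2 : Projective T.X₂ := (IsProjective.iff_projective (R := R) (ι →₀ B)).1 hB'
  exact (hT.hasProjectiveDimensionLT_X₃_iff n hT2).2
    (ih ((hS.hasProjectiveDimensionLT_X₃_iff n hS2).1 h))

lemma finsupp_pd (R : Type u) [CommRing R] (ι : Type u) (n : ℕ) :
    ∀ (M : Type u) [AddCommGroup M] [Module R M], HasProjectiveDimensionLE (ModuleCat.of R M) n →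
      HasProjectiveDimensionLE (ModuleCat.of R (ι →₀ M)) n := by
  induction n with
  | zero =>
    intro M _ _ h
    rw [← projective_iff_hasProjectiveDimensionLE_zero, ← IsProjective.iff_projective] at h ⊢
    classical
    have hd : Module.Projective R (Π₀ _ : ι, M) := inferInstance
    exact Module.Projective.of_equiv (finsuppLequivDFinsupp (ι := ι) (M := M) R).symm
  | succ n ih =>
    intro M _ _ h
    let p : (M →₀ R) →ₗ[R] M := Finsupp.linearCombination R id
    have hp : Function.Surjective p := Finsupp.linearCombination_id_surjective R M
    exact finsupp_pd_step R ι n p.ker (M →₀ R) M p.ker.subtype p p.ker.injective_subtype hp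
      (LinearMap.exact_subtype_ker_map p) inferInstance inferInstance (ih p.ker) h

/-- For a domain `R` which is not a field, with quotient field `Q`:
if `gldim R = pd_R Q + 1` then `cot.D R = pd_R Q`. -/
theorem stmt_12 (R : Type u) [CommRing R] [IsDomain R] (hnf : ¬ IsField R)
    (h : gldim R = pd R (ModuleCat.of R (FractionRing R)) + 1) :
    cotD R = pd R (ModuleCat.of R (FractionRing R)) := by
  apply le_antisymm
  · generalize hd : pd R (ModuleCat.of R (FractionRing R)) = d at h
    induction d using ENat.recTopCoe with
    | top => exact le_top
    | coe n =>
    refine iSup₂_le fun F hF => ?_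
    rw [pd_le_iff]
    have hQ := (pd_le_iff R _ n).1 hd.le
    have hG : ∀ M : ModuleCat.{u} R, HasProjectiveDimensionLE M (n + 1) := fun M => by
      rw [← pd_le_iff]
      have : pd R M ≤ gldim R := le_iSup (pd R) M
      rw [h] at this
      exact_mod_cast this
    let K := FractionRing R
    let V := TensorProduct R K F
    let b := Module.Free.chooseBasis K V
    let e : V ≃ₗ[R] (Module.Free.ChooseBasisIndex K V →₀ K) := b.repr.restrictScalars R
    have hV : HasProjectiveDimensionLE (ModuleCat.of R V) n := by
      have := finsupp_pd R (Module.Free.ChooseBasisIndex K V) n K hQ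
      exact ModuleCat.hasProjectiveDimensionLE_of_linearEquiv
        (M := ModuleCat.of R (Module.Free.ChooseBasisIndex K V →₀ K))
        (N := ModuleCat.of R V) e.symm n
    let i : F →ₗ[R] V := TensorProduct.mk R K F 1
    have hi : Function.Injective i := by
      have h1 := Module.Flat.rTensor_preserves_injective_linearMap (M := F)
        (Algebra.linearMap R K) (IsFractionRing.injective R K)
      have h2 : i = (LinearMap.rTensor F (Algebra.linearMap R K)) ∘ₗ
          (TensorProduct.lid R F).symm.toLinearMap := by
        ext x; simp [i]; rfl
      rw [h2]
      exact h1.comp (TensorProduct.lid R F).symm.injective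
    let S : ShortComplex (ModuleCat.{u} R) :=
      ShortComplex.mk (ModuleCat.ofHom i) (ModuleCat.ofHom i.range.mkQ)
        (by
          apply ModuleCat.hom_ext
          refine LinearMap.ext fun x => ?_
          exact (Submodule.Quotient.mk_eq_zero _).2 ⟨x, rfl⟩)
    have hS : S.ShortExact :=
      { exact := (ShortComplex.moduleCat_exact_iff _).2 fun x hx =>
          (Submodule.Quotient.mk_eq_zero _).1 hx
        mono_f := (ModuleCat.mono_iff_injective _).2 hi
        epi_g := (ModuleCat.epi_iff_surjective _).2 i.range.mkQ_surjective }
    exact hS.hasProjectiveDimensionLT_X₁ (n + 1) hV (hG _)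
  · exact le_iSup₂_of_le (ModuleCat.of R (FractionRing R))
      (IsLocalization.flat (FractionRing R) (nonZeroDivisors R)) le_rfl
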